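/- Let n = 4k + 2 with k ≥ 2 an integer. Let q_1 be the permutation of {1,...,n} with q_1(1)=1, q_1(n)=n, q_1(i)=i+1 for even i with 2 ≤ i ≤ n−2, q_1(i)=i−1 for odd i with 3 ≤ i ≤ n−1, and q_2 the permutation with q_2(i)=i−1 for even i and q_2(i)=i+1 for odd i; let Q_1, Q_2 be their permutation matrices. Let E'_n be the DFA with the three letters Ī_{1,n−4}, Q_1, Q_2, where Ī_{1,n−4} is the binary row-stochastic matrix of the map sending state 1 to state n−4 and fixing every other state. Then E'_n is synchronizing and the diameter of its square graph S(E'_n) equals (n² + 2n − 12)/4. -/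

import Mathlib

open Matrix

/-- The 0/1 matrix of a map on states `{1, ..., n}` described by `f : ℕ → ℕ`
(state `a` corresponds to the index `a.val + 1`): entry `(a, b)` is `1` iff
`f (a+1) = b+1` in the 1-indexed labels. -/
def matOfFun (n : ℕ) (f : ℕ → ℕ) : Matrix (Fin n) (Fin n) ℕ :=
  Matrix.of fun a b => if f (a.val + 1) = b.val + 1 then 1 else 0

/-- The permutation matrix of `q₁` with `q₁(1)=1`, `q₁(n)=n`, `q₁(i)=i+1` for even `i`
with `2 ≤ i ≤ n−2`, `q₁(i)=i−1` for odd `i` with `3 ≤ i ≤ n−1`. -/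
def Q1mat (n : ℕ) : Matrix (Fin n) (Fin n) ℕ :=
  matOfFun n fun s => if s = 1 then 1 else if s = n then n
    else if s % 2 = 0 then s + 1 else s - 1

/-- The permutation matrix of `q₂` with `q₂(i)=i−1` for even `i`, `q₂(i)=i+1` for odd
`i`. -/
def Q2mat (n : ℕ) : Matrix (Fin n) (Fin n) ℕ :=
  matOfFun n fun s => if s % 2 = 0 then s - 1 else s + 1

/-- The letter `Ī_{1,n−4}`: the row-stochastic matrix of the map sending state `1` to
state `n − 4` and fixing every other state. -/
def IbarMat (n : ℕ) : Matrix (Fin n) (Fin n) ℕ :=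
  matOfFun n fun s => if s = 1 then n - 4 else s

/-- The DFA `E'_n` on `n` states with the three letters `Ī_{1,n−4}, Q₁, Q₂`. -/
def En (n : ℕ) : Set (Matrix (Fin n) (Fin n) ℕ) :=
  {IbarMat n, Q1mat n, Q2mat n}

/-- A DFA (set of row-stochastic matrices) `S` is synchronizing: some nonempty product of
its matrices has an all-positive column. -/
def IsSync {n : ℕ} (S : Set (Matrix (Fin n) (Fin n) ℕ)) : Prop :=
  ∃ ws : List (Matrix (Fin n) (Fin n) ℕ), ws ≠ [] ∧ (∀ A ∈ ws, A ∈ S) ∧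
    ∃ j, ∀ i, 0 < ws.prod i j

/-- One edge of the square graph of the DFA `S`: the (unordered) pair `u` moves to the
pair `v` by some letter of `S`. -/
def sqStep {n : ℕ} (S : Set (Matrix (Fin n) (Fin n) ℕ))
    (u v : Fin n × Fin n) : Prop :=
  ∃ A ∈ S, (0 < A u.1 v.1 ∧ 0 < A u.2 v.2) ∨ (0 < A u.1 v.2 ∧ 0 < A u.2 v.1)

/-- `stepsTo r k u v`: there is a directed path of length `k` from `u` to `v` using the
edge relation `r`. -/
def stepsTo {V : Type*} (r : V → V → Prop) : ℕ → V → V → Prop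
  | 0, u, v => u = v
  | k + 1, u, v => ∃ w, r u w ∧ stepsTo r k w v

/-- The distance in the square graph from a vertex `u` to the nearest singleton. -/
noncomputable def sqDistToSingleton {n : ℕ} (S : Set (Matrix (Fin n) (Fin n) ℕ))
    (u : Fin n × Fin n) : ℕ :=
  sInf {k | ∃ s : Fin n, stepsTo (sqStep S) k u (s, s)}

/-- The diameter of the square graph of the DFA `S`: the maximum over non-singleton
vertices of the distance to the nearest singleton. -/
noncomputable def sqDiam {n : ℕ} (S : Set (Matrix (Fin n) (Fin n) ℕ)) : ℕ :=
  sSup {d | ∃ u : Fin n × Fin n, u.1 ≠ u.2 ∧ sqDistToSingleton S u = d}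

set_option linter.unusedVariables false
/-- index (multiple of the jump length) of the difference class `d` -/
def Jf (k d : ℤ) : ℤ :=
  if d % 2 = 0 then (if d % 4 = 0 then d / 2 else (4 * k + 2 - d) / 2)
  else if d < 2 * k + 1 then
    (if (d + 2 * k + 1) % 4 = 2 then (d + 2 * k + 1) / 2 else (2 * k + 1 - d) / 2)
  else (if (d - 2 * k - 1) % 4 = 2 then (d - 2 * k - 1) / 2 else (6 * k + 3 - d) / 2)

/-- distance to the exit inside of the class `d` -/
def Wf (k d u : ℤ) : ℤ :=
  if d = 2 * k + 1 then (if u ≤ 2 * k then 2 * k - u else u - (2 * k + 1))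
  else if (d % 4 = 0 ∨ (d < 2 * k + 1 ∧ (d + 2 * k + 1) % 4 = 2) ∨
      (2 * k + 1 < d ∧ (d - 2 * k - 1) % 4 = 2))
    then (if u ≤ d then d - u else u - d)
    else (if u ≤ d - 1 then d - 1 - u else u - (d - 1))

/-- distance from the entry to the exit of class `j` -/
def Lf (k : ℤ) (j : ℤ) : ℤ :=
  if j = 0 then 0
  else if j % 2 = 0 then
    (if j < k then 4 * (k - j) - 3 else if j = 2 * k then 4 * k - 2 else 4 * (j - k) + 3)
  else (if j ≤ k - 2 then 4 * j + 5 else if j ≤ k then 4 * k - 2 else 8 * k - 1 - 4 * j)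

/-- distance from the exit of class `j` to a singleton -/
def Kf (k : ℤ) : ℕ → ℤ
  | 0 => 0
  | j + 1 => Kf k j + Lf k j + 1

def df (p q : ℤ) : ℤ := if p ≤ q then q - p else p - q

def uf (p q : ℤ) : ℤ := if 0 ≤ p + q then p + q else -1 - (p + q)

/-- the distance function -/
def Pf (k p q : ℤ) : ℤ :=
  if p = q then 0 else Wf k (df p q) (uf p q) + Kf k (Jf k (df p q)).toNat

def f1 (k p : ℤ) : ℤ := if p = -(2 * k + 1) then p else -p

def f2 (p : ℤ) : ℤ := -1 - p

def f0 (k p : ℤ) : ℤ := if p = 0 then 2 - (2 * k + 1) else p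

def InR (k p : ℤ) : Prop := -(2 * k + 1) ≤ p ∧ p ≤ 2 * k

theorem df_comm (p q : ℤ) : df p q = df q p := by
  unfold df; split_ifs <;> omega

theorem uf_comm (p q : ℤ) : uf p q = uf q p := by
  unfold uf; rw [add_comm]

theorem Pf_comm (k p q : ℤ) : Pf k p q = Pf k q p := by
  unfold Pf; rw [df_comm, uf_comm]; simp only [eq_comm]

theorem Lf_nonneg (k : ℤ) (hk : 2 ≤ k) (j : ℤ) (h0 : 0 ≤ j) (hj : j ≤ 2 * k) : 0 ≤ Lf k j := by
  unfold Lf; split_ifs <;> omega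

theorem Kf_mono (k : ℤ) (hk : 2 ≤ k) (i m : ℕ) (him : i ≤ m) (hm : (m : ℤ) ≤ 2 * k + 1) :
    Kf k i ≤ Kf k m := by
  induction m, him using Nat.le_induction with
  | base => rfl
  | succ m _ ih =>
    have := ih (by push_cast at hm; omega)
    have h2 := Lf_nonneg k hk m (by omega) (by push_cast at hm; omega)
    simp only [Kf]; omega

theorem Jf_symm (k d : ℤ) (h1 : 1 ≤ d) (h2 : d ≤ 4 * k + 1) :
    Jf k (4 * k + 2 - d) = Jf k d := by
  unfold Jf; split_ifs <;> omega

theorem Jf_range (k d : ℤ) (hk : 2 ≤ k) (h1 : 1 ≤ d) (h2 : d ≤ 4 * k + 1) :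
    1 ≤ Jf k d ∧ Jf k d ≤ 2 * k + 1 := by
  unfold Jf; split_ifs <;> omega

theorem Wf_nonneg (k d u : ℤ) : 0 ≤ Wf k d u := by
  unfold Wf; split_ifs <;> omega

set_option maxHeartbeats 2000000 in
theorem Wf_symm (k d u : ℤ) (h1 : 1 ≤ d) (h2 : d ≤ 4 * k + 1) :
    Wf k (4 * k + 2 - d) (4 * k + 1 - u) = Wf k d u := by
  unfold Wf; split_ifs <;> omega

theorem Wf_lip (k d u : ℤ) : Wf k d (u + 1) ≤ Wf k d u + 1 ∧ Wf k d u ≤ Wf k d (u + 1) + 1 := by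
  unfold Wf; split_ifs <;> omega

theorem Wf_dec (k d u : ℤ) (h1 : 1 ≤ d) (h2 : d ≤ 4 * k + 1) (hu : 0 ≤ u) (hu2 : u ≤ 4 * k + 1)
    (hW : Wf k d u ≠ 0) :
    (1 ≤ u ∧ Wf k d (u - 1) + 1 = Wf k d u) ∨ (u ≤ 4 * k ∧ Wf k d (u + 1) + 1 = Wf k d u) := by
  unfold Wf at *; split_ifs at * <;> omega

theorem du_range (k p q : ℤ) (hp : InR k p) (hq : InR k q) (h : p ≠ q) :
    1 ≤ df p q ∧ df p q ≤ 4 * k + 1 ∧ 0 ≤ uf p q ∧ uf p q ≤ 4 * k + 1 := by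
  unfold InR at *; unfold df uf; split_ifs <;> omega

/-- motion of `(d,u)` up to the symmetry -/
def Mv (k d u d' u' : ℤ) : Prop := (d' = d ∧ u' = u) ∨ (d' = 4 * k + 2 - d ∧ u' = 4 * k + 1 - u)


theorem q_step1 (k p q : ℤ) (hk : 2 ≤ k) (hp : InR k p) (hq : InR k q) (h : p < q) :
    ((uf p q - df p q) % 2 = 0 ∧ uf p q = 0 ∧
      Mv k (df p q) (uf p q) (df (f1 k p) (f1 k q)) (uf (f1 k p) (f1 k q))) ∨
    ((uf p q - df p q) % 2 = 0 ∧
      Mv k (df p q) (uf p q - 1) (df (f1 k p) (f1 k q)) (uf (f1 k p) (f1 k q))) ∨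
    ((uf p q - df p q) % 2 = 1 ∧
      Mv k (df p q) (uf p q + 1) (df (f1 k p) (f1 k q)) (uf (f1 k p) (f1 k q))) := by
  unfold InR Mv at *
  unfold df uf f1
  by_cases c1 : p = -(2 * k + 1) <;> by_cases c2 : q = -(2 * k + 1) <;>
    simp only [c1, c2, if_true, if_false] <;> split_ifs <;> omega

theorem q_step2 (k p q : ℤ) (hk : 2 ≤ k) (hp : InR k p) (hq : InR k q) (h : p < q) :
    ((uf p q - df p q) % 2 = 1 ∧ uf p q = 0 ∧
      Mv k (df p q) (uf p q) (df (f2 p) (f2 q)) (uf (f2 p) (f2 q))) ∨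
    ((uf p q - df p q) % 2 = 1 ∧
      Mv k (df p q) (uf p q - 1) (df (f2 p) (f2 q)) (uf (f2 p) (f2 q))) ∨
    ((uf p q - df p q) % 2 = 0 ∧
      Mv k (df p q) (uf p q + 1) (df (f2 p) (f2 q)) (uf (f2 p) (f2 q))) := by
  unfold InR Mv at *
  unfold df uf f2
  split_ifs <;> omega

theorem Mv_W (k d u d' u' : ℤ) (h1 : 1 ≤ d) (h2 : d ≤ 4 * k + 1) (h : Mv k d u d' u') :
    Wf k d' u' = Wf k d u ∧ Jf k d' = Jf k d := by
  rcases h with ⟨rfl, rfl⟩ | ⟨rfl, rfl⟩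
  · exact ⟨rfl, rfl⟩
  · exact ⟨Wf_symm k d u h1 h2, Jf_symm k d h1 h2⟩

theorem f1_inj (k p q : ℤ) (hp : InR k p) (hq : InR k q) (h : p ≠ q) : f1 k p ≠ f1 k q := by
  unfold InR f1 at *; split_ifs <;> omega

theorem f2_inj (p q : ℤ) (h : p ≠ q) : f2 p ≠ f2 q := by
  unfold f2 at *; omega

theorem Pf_ne (k p q : ℤ) (h : p ≠ q) :
    Pf k p q = Wf k (df p q) (uf p q) + Kf k (Jf k (df p q)).toNat := by
  unfold Pf; rw [if_neg h]

theorem Pf_Mv (k p q p' q' v : ℤ) (hp : InR k p) (hq : InR k q) (h : p ≠ q) (h' : p' ≠ q')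
    (hM : Mv k (df p q) v (df p' q') (uf p' q')) :
    Pf k p' q' = Wf k (df p q) v + Kf k (Jf k (df p q)).toNat := by
  obtain ⟨a, b, -, -⟩ := du_range k p q hp hq h
  obtain ⟨c, d⟩ := Mv_W k _ _ _ _ a b hM
  rw [Pf_ne k p' q' h', c, d]

/-- Lipschitz for the permutation letters. -/
theorem Q_lip (k p q : ℤ) (hk : 2 ≤ k) (hp : InR k p) (hq : InR k q) (h : p < q) :
    Pf k p q ≤ Pf k (f1 k p) (f1 k q) + 1 ∧ Pf k p q ≤ Pf k (f2 p) (f2 q) + 1 := by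
  have hne : p ≠ q := by omega
  have l1 := Wf_lip k (df p q) (uf p q)
  have l2 := Wf_lip k (df p q) (uf p q - 1)
  rw [sub_add_cancel] at l2
  have e := Pf_ne k p q hne
  constructor
  · rcases q_step1 k p q hk hp hq h with ⟨_, _, hM⟩ | ⟨_, hM⟩ | ⟨_, hM⟩ <;>
    · have := Pf_Mv k p q _ _ _ hp hq hne (f1_inj k p q hp hq hne) hM
      omega
  · rcases q_step2 k p q hk hp hq h with ⟨_, _, hM⟩ | ⟨_, hM⟩ | ⟨_, hM⟩ <;>
    · have := Pf_Mv k p q _ _ _ hp hq hne (f2_inj p q hne) hM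
      omega

theorem Q_dec (k p q : ℤ) (hk : 2 ≤ k) (hp : InR k p) (hq : InR k q) (h : p < q)
    (hW : Wf k (df p q) (uf p q) ≠ 0) :
    Pf k (f1 k p) (f1 k q) + 1 = Pf k p q ∨ Pf k (f2 p) (f2 q) + 1 = Pf k p q := by
  have hne : p ≠ q := by omega
  obtain ⟨a, b, c, d⟩ := du_range k p q hp hq hne
  have hd := Wf_dec k _ _ a b c d hW
  have e := Pf_ne k p q hne
  rcases q_step1 k p q hk hp hq h with ⟨h1, h2, hM⟩ | ⟨h1, hM⟩ | ⟨h1, hM⟩ <;>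
  rcases q_step2 k p q hk hp hq h with ⟨h1', h2', hM'⟩ | ⟨h1', hM'⟩ | ⟨h1', hM'⟩ <;>
  · have g1 := Pf_Mv k p q _ _ _ hp hq hne (f1_inj k p q hp hq hne) hM
    have g2 := Pf_Mv k p q _ _ _ hp hq hne (f2_inj p q hne) hM'
    omega



/-- Description of the class of `d` and of the distance to its exit. -/
theorem JW_spec (k d u : ℤ) (hk : 2 ≤ k) (h1 : 1 ≤ d) (h2 : d ≤ 4 * k + 1) :
    1 ≤ Jf k d ∧ Jf k d ≤ 2 * k + 1 ∧ ∃ e : ℤ,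
    ((u ≤ e ∧ Wf k d u = e - u) ∨ (e < u ∧ Wf k d u = u - e)) ∧
    ((Jf k d % 2 = 0 ∧ d = 2 * Jf k d ∧ e = d) ∨
     (Jf k d % 2 = 0 ∧ d = 4 * k + 2 - 2 * Jf k d ∧ e = d - 1) ∨
     (Jf k d % 2 = 1 ∧ Jf k d ≤ k ∧ d = 2 * Jf k d + (2 * k + 1) ∧ e = d) ∨
     (Jf k d % 2 = 1 ∧ k < Jf k d ∧ Jf k d ≤ 2 * k ∧ d = 2 * Jf k d - (2 * k + 1) ∧ e = d) ∨
     (Jf k d % 2 = 1 ∧ Jf k d ≤ k ∧ d = (2 * k + 1) - 2 * Jf k d ∧ e = d - 1) ∨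
     (Jf k d % 2 = 1 ∧ k < Jf k d ∧ Jf k d ≤ 2 * k ∧ d = 3 * (2 * k + 1) - 2 * Jf k d ∧ e = d - 1) ∨
     (Jf k d = 2 * k + 1 ∧ d = 2 * k + 1 ∧ ((u ≤ 2 * k ∧ e = 2 * k) ∨ (2 * k < u ∧ e = 2 * k + 1)))) := by
  refine ⟨(Jf_range k d hk h1 h2).1, (Jf_range k d hk h1 h2).2, ?_⟩
  by_cases c0 : d = 2 * k + 1
  · have hJ : Jf k d = 2 * k + 1 := by unfold Jf; split_ifs <;> omega
    rw [hJ]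
    by_cases c1 : u ≤ 2 * k
    · refine ⟨2 * k, ?_, by omega⟩
      unfold Wf; rw [if_pos c0, if_pos c1]; omega
    · refine ⟨2 * k + 1, ?_, by omega⟩
      unfold Wf; rw [if_pos c0, if_neg c1]; omega
  by_cases c1 : (d % 4 = 0 ∨ (d < 2 * k + 1 ∧ (d + 2 * k + 1) % 4 = 2) ∨
      (2 * k + 1 < d ∧ (d - 2 * k - 1) % 4 = 2))
  · refine ⟨d, ?_, ?_⟩
    · unfold Wf; rw [if_neg c0, if_pos c1]
      split_ifs with c2
      · exact Or.inl ⟨c2, rfl⟩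
      · exact Or.inr ⟨not_le.mp c2, rfl⟩
    · rcases c1 with c1 | ⟨c1, c2⟩ | ⟨c1, c2⟩
      · have hJ : Jf k d = d / 2 := by
          unfold Jf; rw [if_pos (by omega), if_pos c1]
        rw [hJ]
        left; omega
      · have hJ : Jf k d = (d + 2 * k + 1) / 2 := by
          unfold Jf; rw [if_neg (by omega), if_pos c1, if_pos c2]
        rw [hJ]
        iterate 3 right
        left; omega
      · have hJ : Jf k d = (d - 2 * k - 1) / 2 := by
          unfold Jf; rw [if_neg (by omega), if_neg (by omega), if_pos c2]
        rw [hJ]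
        iterate 2 right
        left; omega
  · refine ⟨d - 1, ?_, ?_⟩
    · unfold Wf; rw [if_neg c0, if_neg c1]
      split_ifs with c2
      · exact Or.inl ⟨c2, rfl⟩
      · exact Or.inr ⟨not_le.mp c2, rfl⟩
    · rw [not_or, not_or, not_and, not_and] at c1
      obtain ⟨c1, c2, c3⟩ := c1
      by_cases c4 : d % 2 = 0
      · have hJ : Jf k d = (4 * k + 2 - d) / 2 := by
          unfold Jf; rw [if_pos c4, if_neg c1]
        rw [hJ]
        clear c2 c3
        right; left; omega
      · by_cases c5 : d < 2 * k + 1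
        · have c2 := c2 c5
          have hJ : Jf k d = (2 * k + 1 - d) / 2 := by
            unfold Jf; rw [if_neg c4, if_pos c5, if_neg c2]
          rw [hJ]
          iterate 4 right
          left; clear c3 c1; omega
        · have c3 := c3 (by omega)
          have hJ : Jf k d = (6 * k + 3 - d) / 2 := by
            unfold Jf; rw [if_neg c4, if_neg c5, if_neg c3]
          rw [hJ]
          iterate 5 right
          left; clear c2 c1; omega

theorem L_spec (k j : ℤ) (hj : 1 ≤ j) :
    (j % 2 = 0 ∧ j < k ∧ Lf k j = 4 * (k - j) - 3) ∨ (j = 2 * k ∧ k ≤ j ∧ Lf k j = 4 * k - 2) ∨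
    (j % 2 = 0 ∧ k ≤ j ∧ j ≠ 2 * k ∧ Lf k j = 4 * (j - k) + 3) ∨
    (j % 2 = 1 ∧ j ≤ k - 2 ∧ Lf k j = 4 * j + 5) ∨
    (j % 2 = 1 ∧ k - 2 < j ∧ j ≤ k ∧ Lf k j = 4 * k - 2) ∨
    (j % 2 = 1 ∧ k < j ∧ Lf k j = 8 * k - 1 - 4 * j) := by
  unfold Lf; split_ifs <;> omega

theorem I_exit1 (k : ℤ) (hk : 2 ≤ k) :
    Jf k (df 0 (1 - 2 * k)) = 1 ∧
    Wf k (df 0 (1 - 2 * k)) (uf 0 (1 - 2 * k)) = 0 := by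
  have e1 : df 0 (1 - 2 * k) = 2 * k - 1 := by unfold df; split_ifs <;> omega
  have e2 : uf 0 (1 - 2 * k) = 2 * k - 2 := by unfold uf; split_ifs <;> omega
  rw [e1, e2]
  obtain ⟨a, b, e, hW, hc⟩ := JW_spec k (2 * k - 1) (2 * k - 2) hk (by omega) (by omega)
  omega

/-- The jump, in terms of `d`, `u`. -/
theorem I_spec (k q : ℤ) (hk : 2 ≤ k) (hq : InR k q) (h : q ≠ 0) (h2 : q ≠ 1 - 2 * k) :
    ∃ d u d' u', df 0 q = d ∧ uf 0 q = u ∧ df (1 - 2 * k) q = d' ∧ uf (1 - 2 * k) q = u' ∧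
    1 ≤ d ∧ d ≤ 4 * k + 1 ∧ 1 ≤ d' ∧ d' ≤ 4 * k + 1 ∧
    ((d ≤ 2 * k ∧ u = d ∧ d' = d + 2 * k - 1 ∧
      ((d < 2 * k - 1 ∧ u' = 2 * k - 2 - d) ∨ (2 * k - 1 ≤ d ∧ u' = 1 - 2 * k + d))) ∨
     (d < 2 * k - 1 ∧ u = d - 1 ∧ d' = 2 * k - 1 - d ∧ u' = 2 * k - 2 + d) ∨
     (2 * k - 1 < d ∧ d ≤ 2 * k + 1 ∧ u = d - 1 ∧ d' = 1 - 2 * k + d ∧ u' = 2 * k - 2 + d)) := by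
  refine ⟨_, _, _, _, rfl, rfl, rfl, rfl, ?_⟩
  unfold InR at hq
  unfold df uf
  split_ifs <;> omega

set_option maxHeartbeats 1000000 in
/-- The jump from the exit (`W = 0`). -/
theorem I_exit (k q : ℤ) (hk : 2 ≤ k) (hq : InR k q) (h : q ≠ 0)
    (hW : Wf k (df 0 q) (uf 0 q) = 0) (h2 : q ≠ 1 - 2 * k) :
    Jf k (df (1 - 2 * k) q) + 1 = Jf k (df 0 q) ∧
    Wf k (df (1 - 2 * k) q) (uf (1 - 2 * k) q) = Lf k (Jf k (df (1 - 2 * k) q)) := by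
  obtain ⟨d, u, d', u', rfl, rfl, rfl, rfl, r1, r2, r3, r4, hc⟩ := I_spec k q hk hq h h2
  obtain ⟨a, b, e, hW1, hc1⟩ := JW_spec k (df 0 q) (uf 0 q) hk r1 r2
  obtain ⟨a', b', e', hW2, hc2⟩ := JW_spec k (df (1 - 2 * k) q) (uf (1 - 2 * k) q) hk r3 r4
  have hL := L_spec k (Jf k (df (1 - 2 * k) q)) a'
  revert hW hL hW1 hW2 hc hc1 hc2 a b a' b' r1 r2 r3 r4
  generalize Lf k (Jf k (df (1 - 2 * k) q)) = l
  generalize Jf k (df (1 - 2 * k) q) = j'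
  generalize Wf k (df (1 - 2 * k) q) (uf (1 - 2 * k) q) = w'
  generalize Wf k (df 0 q) (uf 0 q) = w
  generalize Jf k (df 0 q) = j
  generalize df 0 q = d
  generalize uf 0 q = u
  generalize df (1 - 2 * k) q = d'
  generalize uf (1 - 2 * k) q = u'
  clear h h2 hq
  intro hW r1 r2 r3 r4 hc a b hW1 hc1 a' b' hW2 hc2 hL
  have he : e = u := by omega
  subst he
  clear hW1 hW
  have hJ : j' + 1 = j := by
    clear hL hW2
    rcases hc with hc | hc | hc <;> rcases hc1 with hc1 | hc1 | hc1 | hc1 | hc1 | hc1 | hc1 <;>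
    first
    | omega
    | (rcases hc2 with hc2 | hc2 | hc2 | hc2 | hc2 | hc2 | hc2 <;> omega)
  refine ⟨hJ, ?_⟩
  rcases hc with hc | hc | hc <;> rcases hc1 with hc1 | hc1 | hc1 | hc1 | hc1 | hc1 | hc1 <;>
    first
    | (exfalso; clear hL hc2 hW2; omega)
    | (rcases hc2 with hc2 | hc2 | hc2 | hc2 | hc2 | hc2 | hc2 <;> first
      | (exfalso; clear hL hW2; omega)
      | (rcases hL with hL | hL | hL | hL | hL | hL <;> omega))

set_option maxHeartbeats 1000000 in
theorem I_other (k q : ℤ) (hk : 2 ≤ k) (hq : InR k q) (h : q ≠ 0)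
    (hW : Wf k (df 0 q) (uf 0 q) ≠ 0) :
    Wf k (df 0 q) (uf 0 q) = 1 ∧ q ≠ 1 - 2 * k ∧ Jf k (df 0 q) ≤ Jf k (df (1 - 2 * k) q) := by
  have h2 : q ≠ 1 - 2 * k := by
    rintro rfl
    exact hW (I_exit1 k hk).2
  obtain ⟨d, u, d', u', rfl, rfl, rfl, rfl, r1, r2, r3, r4, hc⟩ := I_spec k q hk hq h h2
  obtain ⟨a, b, e, hW1, hc1⟩ := JW_spec k (df 0 q) (uf 0 q) hk r1 r2
  obtain ⟨a', b', e', hW2, hc2⟩ := JW_spec k (df (1 - 2 * k) q) (uf (1 - 2 * k) q) hk r3 r4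
  revert hW hW1 hc hc1 hc2 a b a' b' r1 r2 r3 r4
  clear hW2
  generalize Jf k (df (1 - 2 * k) q) = j'
  generalize Wf k (df 0 q) (uf 0 q) = w
  generalize Jf k (df 0 q) = j
  generalize df 0 q = d
  generalize uf 0 q = u
  generalize df (1 - 2 * k) q = d'
  generalize uf (1 - 2 * k) q = u'
  intro hW r1 r2 r3 r4 hc a b hW1 hc1 a' b' hc2
  refine ⟨?_, h2, ?_⟩
  · clear hc2
    rcases hc1 with hc1 | hc1 | hc1 | hc1 | hc1 | hc1 | hc1 <;> omega
  · rcases hc with hc | hc | hc <;> rcases hc1 with hc1 | hc1 | hc1 | hc1 | hc1 | hc1 | hc1 <;>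
    first
    | (exfalso; clear hc2; omega)
    | (rcases hc2 with hc2 | hc2 | hc2 | hc2 | hc2 | hc2 | hc2 <;> omega)
theorem Kf_nonneg (k : ℤ) (hk : 2 ≤ k) (m : ℕ) (hm : (m : ℤ) ≤ 2 * k + 1) : 0 ≤ Kf k m := by
  have := Kf_mono k hk 0 m (Nat.zero_le _) hm
  simpa [Kf] using this

theorem Kf_one (k : ℤ) : Kf k 1 = 1 := by simp [Kf, Lf]

theorem Pf_self (k p : ℤ) : Pf k p p = 0 := by simp [Pf]

theorem Pf_pos (k p q : ℤ) (hk : 2 ≤ k) (hp : InR k p) (hq : InR k q) (h : p ≠ q) :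
    1 ≤ Pf k p q := by
  obtain ⟨a, b, -, -⟩ := du_range k p q hp hq h
  obtain ⟨c, d⟩ := Jf_range k _ hk a b
  have h1 := Kf_mono k hk 1 (Jf k (df p q)).toNat (by omega) (by omega)
  rw [Kf_one] at h1
  rw [Pf_ne k p q h]
  have := Wf_nonneg k (df p q) (uf p q)
  omega

theorem Pf_nonneg (k p q : ℤ) (hk : 2 ≤ k) (hp : InR k p) (hq : InR k q) : 0 ≤ Pf k p q := by
  by_cases h : p = q
  · rw [h, Pf_self]
  · have := Pf_pos k p q hk hp hq h; omega

theorem InR_entry (k : ℤ) (hk : 2 ≤ k) : InR k (1 - 2 * k) := by unfold InR; omega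

theorem I_zero (k q : ℤ) (hk : 2 ≤ k) (hq : InR k q) (h : q ≠ 0) :
    Pf k 0 q ≤ Pf k (1 - 2 * k) q + 1 ∧
    (Wf k (df 0 q) (uf 0 q) = 0 → Pf k (1 - 2 * k) q + 1 = Pf k 0 q) := by
  have e := Pf_ne k 0 q h.symm
  have h0 : InR k 0 := by unfold InR; omega
  by_cases hW : Wf k (df 0 q) (uf 0 q) = 0
  · by_cases h2 : q = 1 - 2 * k
    · subst h2
      rw [hW, (I_exit1 k hk).1, show (1 : ℤ).toNat = 1 from rfl, Kf_one] at e
      rw [e, Pf_self]; simp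
    · obtain ⟨a, b⟩ := I_exit k q hk hq h hW h2
      have e' := Pf_ne k (1 - 2 * k) q (Ne.symm h2)
      obtain ⟨r1, r2, -, -⟩ := du_range k _ q (InR_entry k hk) hq (Ne.symm h2)
      obtain ⟨c, d⟩ := Jf_range k _ hk r1 r2
      have ej : (Jf k (df 0 q)).toNat = (Jf k (df (1 - 2 * k) q)).toNat + 1 := by omega
      rw [ej, Kf, Int.toNat_of_nonneg (by omega)] at e
      have : Pf k (1 - 2 * k) q + 1 = Pf k 0 q := by omega
      exact ⟨by omega, fun _ => this⟩
  · obtain ⟨a, h2, b⟩ := I_other k q hk hq h hW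
    refine ⟨?_, fun h => absurd h hW⟩
    have e' := Pf_ne k (1 - 2 * k) q (Ne.symm h2)
    obtain ⟨r1, r2, -, -⟩ := du_range k _ q (InR_entry k hk) hq (Ne.symm h2)
    obtain ⟨c, d⟩ := Jf_range k _ hk r1 r2
    have := Kf_mono k hk (Jf k (df 0 q)).toNat (Jf k (df (1 - 2 * k) q)).toNat (by omega) (by omega)
    have := Wf_nonneg k (df (1 - 2 * k) q) (uf (1 - 2 * k) q)
    omega

theorem f0_zero (k : ℤ) : f0 k 0 = 1 - 2 * k := by unfold f0; rw [if_pos rfl]; ring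

theorem f0_ne (k p : ℤ) (h : p ≠ 0) : f0 k p = p := by unfold f0; rw [if_neg h]

theorem lip_lt (k p q : ℤ) (hk : 2 ≤ k) (hp : InR k p) (hq : InR k q) (h : p < q) :
    Pf k p q ≤ Pf k (f0 k p) (f0 k q) + 1 ∧ Pf k p q ≤ Pf k (f1 k p) (f1 k q) + 1 ∧
    Pf k p q ≤ Pf k (f2 p) (f2 q) + 1 := by
  refine ⟨?_, Q_lip k p q hk hp hq h⟩
  by_cases h1 : p = 0
  · subst h1
    rw [f0_zero, f0_ne k q (by omega)]
    exact (I_zero k q hk hq (by omega)).1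
  · by_cases h2 : q = 0
    · subst h2
      rw [f0_zero, f0_ne k p h1, Pf_comm, Pf_comm k p]
      exact (I_zero k p hk hp h1).1
    · rw [f0_ne k p h1, f0_ne k q h2]; omega

theorem f0_InR (k p : ℤ) (hk : 2 ≤ k) (hp : InR k p) : InR k (f0 k p) := by
  unfold f0 InR at *; split_ifs <;> omega

theorem f1_InR (k p : ℤ) (hk : 2 ≤ k) (hp : InR k p) : InR k (f1 k p) := by
  unfold f1 InR at *; split_ifs <;> omega

theorem f2_InR (k p : ℤ) (hp : InR k p) : InR k (f2 p) := by
  unfold f2 InR at *; omega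

theorem lip_all (k p q : ℤ) (hk : 2 ≤ k) (hp : InR k p) (hq : InR k q) :
    Pf k p q ≤ Pf k (f0 k p) (f0 k q) + 1 ∧ Pf k p q ≤ Pf k (f1 k p) (f1 k q) + 1 ∧
    Pf k p q ≤ Pf k (f2 p) (f2 q) + 1 := by
  rcases lt_trichotomy p q with h | h | h
  · exact lip_lt k p q hk hp hq h
  · subst h; simp [Pf_self]
  · rw [Pf_comm k p q, Pf_comm k (f0 k p), Pf_comm k (f1 k p), Pf_comm k (f2 p)]
    exact lip_lt k q p hk hq hp h

/-- Where the distance inside the class vanishes, one of the states is `0`. -/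
theorem W_zero (k p q : ℤ) (hk : 2 ≤ k) (hp : InR k p) (hq : InR k q) (h : p < q)
    (hW : Wf k (df p q) (uf p q) = 0) : p = 0 ∨ q = 0 := by
  obtain ⟨a, b, -, -⟩ := du_range k p q hp hq (by omega)
  obtain ⟨-, -, e, h1, h2⟩ := JW_spec k (df p q) (uf p q) hk a b
  have h3 : uf p q = df p q ∨ uf p q = df p q - 1 := by
    rcases h2 with h2 | h2 | h2 | h2 | h2 | h2 | h2 <;> omega
  clear h1 h2
  unfold InR at *
  unfold uf df at h3
  split_ifs at h3 <;> omega

theorem dec_lt (k p q : ℤ) (hk : 2 ≤ k) (hp : InR k p) (hq : InR k q) (h : p < q) :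
    Pf k (f0 k p) (f0 k q) + 1 = Pf k p q ∨ Pf k (f1 k p) (f1 k q) + 1 = Pf k p q ∨
    Pf k (f2 p) (f2 q) + 1 = Pf k p q := by
  by_cases hW : Wf k (df p q) (uf p q) = 0
  · left
    rcases W_zero k p q hk hp hq h hW with h1 | h1
    · subst h1
      rw [f0_zero, f0_ne k q (by omega)]
      exact (I_zero k q hk hq (by omega)).2 hW
    · subst h1
      rw [f0_zero, f0_ne k p (by omega), Pf_comm, Pf_comm k p]
      rw [df_comm, uf_comm] at hW
      exact (I_zero k p hk hp (by omega)).2 hW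
  · right; exact Q_dec k p q hk hp hq h hW

theorem dec_all (k p q : ℤ) (hk : 2 ≤ k) (hp : InR k p) (hq : InR k q) (h : p ≠ q) :
    Pf k (f0 k p) (f0 k q) + 1 = Pf k p q ∨ Pf k (f1 k p) (f1 k q) + 1 = Pf k p q ∨
    Pf k (f2 p) (f2 q) + 1 = Pf k p q := by
  rcases lt_or_gt_of_ne h with h | h
  · exact dec_lt k p q hk hp hq h
  · rw [Pf_comm k p q, Pf_comm k (f0 k p), Pf_comm k (f1 k p), Pf_comm k (f2 p)]
    exact dec_lt k q p hk hq hp h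

/-! Summation -/

theorem Kf_two (k : ℤ) (j : ℕ) :
    Kf k (j + 2) = Kf k j + Lf k j + Lf k (j + 1) + 2 := by
  simp only [Kf]; push_cast; ring

theorem Kf_low (k i : ℕ) (h : 2 * i + 1 ≤ k) : Kf k (2 * i + 1) = 1 + 4 * k * i := by
  induction i with
  | zero => simp [Kf_one]
  | succ i ih =>
    have ih := ih (by omega)
    rw [show 2 * (i + 1) + 1 = (2 * i + 1) + 2 by ring, Kf_two, ih]
    have l1 : Lf k ((2 * i + 1 : ℕ) : ℤ) = 4 * (2 * i + 1) + 5 := by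
      unfold Lf; split_ifs <;> omega
    have l2 : Lf k ((2 * i + 1 : ℕ) + 1 : ℤ) = 4 * (k - (2 * i + 2)) - 3 := by
      unfold Lf; split_ifs <;> omega
    rw [l1, l2]; push_cast; ring

theorem Kf_high (k i0 i : ℕ) (h0 : k < 2 * i0 + 1) (hi : i0 ≤ i) (h : i + 1 ≤ k) :
    Kf k (2 * i + 1) = Kf k (2 * i0 + 1) + (4 * k + 8) * (i - i0) := by
  induction i, hi using Nat.le_induction with
  | base => simp
  | succ i hi ih =>
    have ih := ih (by omega)
    rw [show 2 * (i + 1) + 1 = (2 * i + 1) + 2 by ring, Kf_two, ih]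
    have l1 : Lf k ((2 * i + 1 : ℕ) : ℤ) = 8 * k - 1 - 4 * (2 * i + 1) := by
      unfold Lf; split_ifs <;> omega
    have l2 : Lf k ((2 * i + 1 : ℕ) + 1 : ℤ) = 4 * ((2 * i + 2) - k) + 3 := by
      unfold Lf; split_ifs <;> omega
    rw [l1, l2]; push_cast; ring

theorem Kf_top (k : ℕ) (hk : 2 ≤ k) : Kf k (2 * k + 1) = 4 * k ^ 2 + 4 * k - 1 := by
  obtain ⟨r, rfl⟩ : ∃ r, k = r + 1 := ⟨k - 1, by omega⟩
  rw [show 2 * (r + 1) + 1 = (2 * r + 1) + 2 by ring, Kf_two]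
  have l1 : Lf (r + 1 : ℕ) ((2 * r + 1 : ℕ) : ℤ) = 3 := by
    unfold Lf; split_ifs <;> omega
  have l2 : Lf (r + 1 : ℕ) ((2 * r + 1 : ℕ) + 1 : ℤ) = 4 * (r + 1) - 2 := by
    unfold Lf; split_ifs <;> omega
  rw [l1, l2]
  rcases Nat.even_or_odd' (r + 1) with ⟨m, hm | hm⟩
  · obtain ⟨m, rfl⟩ : ∃ s, m = s + 1 := ⟨m - 1, by omega⟩
    rw [Kf_high (r + 1) (m + 1) r (by omega) (by omega) (by omega)]
    rw [show 2 * (m + 1) + 1 = (2 * m + 1) + 2 by ring, Kf_two, Kf_low (r + 1) m (by omega)]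
    have l3 : Lf (r + 1 : ℕ) ((2 * m + 1 : ℕ) : ℤ) = 4 * (r + 1) - 2 := by
      unfold Lf; split_ifs <;> omega
    have l4 : Lf (r + 1 : ℕ) ((2 * m + 1 : ℕ) + 1 : ℤ) = 3 := by
      unfold Lf; split_ifs <;> omega
    rw [l3, l4]
    have : (r : ℤ) = 2 * m + 1 := by omega
    push_cast; rw [this]; ring
  · rw [Kf_high (r + 1) (m + 1) r (by omega) (by omega) (by omega)]
    rw [show 2 * (m + 1) + 1 = (2 * m + 1) + 2 by ring, Kf_two, Kf_low (r + 1) m (by omega)]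
    have l3 : Lf (r + 1 : ℕ) ((2 * m + 1 : ℕ) : ℤ) = 4 * (r + 1) - 2 := by
      unfold Lf; split_ifs <;> omega
    have l4 : Lf (r + 1 : ℕ) ((2 * m + 1 : ℕ) + 1 : ℤ) = 7 := by
      unfold Lf; split_ifs <;> omega
    rw [l3, l4]
    have : (r : ℤ) = 2 * m := by omega
    push_cast; rw [this]; ring

theorem Pf_le (k : ℕ) (p q : ℤ) (hk : 2 ≤ k) (hp : InR k p) (hq : InR k q) :
    Pf k p q ≤ 4 * k ^ 2 + 6 * k - 1 := by
  have hk' : (2 : ℤ) ≤ k := by omega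
  have ht := Kf_top k hk
  by_cases h : p = q
  · rw [h, Pf_self]; nlinarith
  obtain ⟨a, b, c, d⟩ := du_range k p q hp hq h
  obtain ⟨j1, j2, e, h1, h2⟩ := JW_spec k (df p q) (uf p q) hk' a b
  rw [Pf_ne k p q h]
  by_cases hj : Jf k (df p q) = 2 * k + 1
  · have e1 : (Jf k (df p q)).toNat = 2 * k + 1 := by omega
    rw [e1, ht]
    have : Wf k (df p q) (uf p q) ≤ 2 * k := by
      rcases h2 with h2 | h2 | h2 | h2 | h2 | h2 | h2 <;> omega
    linarith
  · have hm := Kf_mono k hk' (Jf k (df p q)).toNat (2 * k) (by omega) (by push_cast; omega)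
    have hl : Lf k ((2 * k : ℕ) : ℤ) = 4 * k - 2 := by unfold Lf; split_ifs <;> omega
    rw [Kf, hl] at ht
    have : Wf k (df p q) (uf p q) ≤ 4 * k + 1 := by
      rcases h2 with h2 | h2 | h2 | h2 | h2 | h2 | h2 <;> omega
    linarith

theorem Pf_max (k : ℕ) (hk : 2 ≤ k) :
    Pf k (-(k + 1)) k = 4 * k ^ 2 + 6 * k - 1 := by
  have ht := Kf_top k hk
  rw [Pf_ne _ _ _ (by omega)]
  have e1 : df (-(k + 1)) k = 2 * k + 1 := by unfold df; split_ifs <;> omega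
  have e2 : uf (-(k + 1)) k = 0 := by unfold uf; split_ifs <;> omega
  rw [e1, e2]
  obtain ⟨j1, j2, e, h1, h2⟩ := JW_spec k (2 * k + 1) 0 (by omega) (by omega) (by omega)
  have e3 : Jf k (2 * k + 1) = 2 * k + 1 := by omega
  have e4 : Wf k (2 * k + 1) 0 = 2 * k := by omega
  rw [e3, e4, show (2 * (k : ℤ) + 1).toNat = 2 * k + 1 by omega, ht]
  ring
/-- coordinate of the state with index `a` (label `a + 1`) -/
def Pn (a : ℕ) : ℤ := if a % 2 = 0 then ((a / 2 : ℕ) : ℤ) else -(((a + 1) / 2 : ℕ) : ℤ)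

theorem Pn_inj (a b : ℕ) (h : Pn a = Pn b) : a = b := by
  unfold Pn at h; split_ifs at h <;> omega

theorem Pn_InR (k a : ℕ) (h : a < 4 * k + 2) : InR k (Pn a) := by
  unfold Pn InR; split_ifs <;> omega

theorem letter_aux (n : ℕ) (g : ℕ → ℕ) (f : ℤ → ℤ)
    (hg : ∀ a < n, 1 ≤ g (a + 1) ∧ g (a + 1) ≤ n ∧ Pn (g (a + 1) - 1) = f (Pn a)) :
    ∃ F : Fin n → Fin n, (∀ a b, 0 < matOfFun n g a b ↔ b = F a) ∧
      ∀ a, Pn (F a) = f (Pn a) := by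
  refine ⟨fun a => ⟨g (a.val + 1) - 1, by have := hg a a.2; omega⟩, ?_, ?_⟩
  · intro a b
    have := hg a a.2
    simp only [matOfFun, Matrix.of_apply, Fin.ext_iff]
    split_ifs <;> simp <;> omega
  · intro a
    exact (hg a a.2).2.2

theorem letter0 (k : ℕ) (hk : 2 ≤ k) :
    ∃ F : Fin (4 * k + 2) → Fin (4 * k + 2), (∀ a b, 0 < IbarMat (4 * k + 2) a b ↔ b = F a) ∧
      ∀ a, Pn (F a) = f0 k (Pn a) := by
  refine letter_aux _ _ _ ?_
  intro a ha
  unfold Pn f0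
  by_cases h : a = 0
  · subst h; simp only [zero_add, if_true]; simp; split_ifs <;> omega
  · rw [if_neg (by omega)]
    refine ⟨by omega, by omega, ?_⟩
    split_ifs <;> omega

theorem letter1 (k : ℕ) (hk : 2 ≤ k) :
    ∃ F : Fin (4 * k + 2) → Fin (4 * k + 2), (∀ a b, 0 < Q1mat (4 * k + 2) a b ↔ b = F a) ∧
      ∀ a, Pn (F a) = f1 k (Pn a) := by
  refine letter_aux _ _ _ ?_
  intro a ha
  unfold Pn f1
  refine ⟨?_, ?_, ?_⟩ <;> split_ifs <;> omega

theorem letter2 (k : ℕ) (hk : 2 ≤ k) :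
    ∃ F : Fin (4 * k + 2) → Fin (4 * k + 2), (∀ a b, 0 < Q2mat (4 * k + 2) a b ↔ b = F a) ∧
      ∀ a, Pn (F a) = f2 (Pn a) := by
  refine letter_aux _ _ _ ?_
  intro a ha
  unfold Pn f2
  refine ⟨?_, ?_, ?_⟩ <;> split_ifs <;> omega

theorem step_lip (k : ℕ) (hk : 2 ≤ k) (u v : Fin (4 * k + 2) × Fin (4 * k + 2))
    (h : sqStep (En (4 * k + 2)) u v) :
    Pf k (Pn u.1) (Pn u.2) ≤ Pf k (Pn v.1) (Pn v.2) + 1 := by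
  obtain ⟨A, hA, h⟩ := h
  have hl := lip_all k (Pn u.1) (Pn u.2) (by omega) (Pn_InR k _ u.1.2) (Pn_InR k _ u.2.2)
  have key : ∀ (f : ℤ → ℤ), (∃ F : Fin (4 * k + 2) → Fin (4 * k + 2),
      (∀ a b, 0 < A a b ↔ b = F a) ∧ ∀ a, Pn (F a) = f (Pn a)) →
      Pf k (Pn v.1) (Pn v.2) = Pf k (f (Pn u.1)) (f (Pn u.2)) := by
    rintro f ⟨F, hF, hf⟩
    simp only [hF] at h
    rcases h with ⟨h1, h2⟩ | ⟨h1, h2⟩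
    · rw [h1, h2, hf, hf]
    · rw [h1, h2, hf, hf, Pf_comm]
  rcases hA with rfl | rfl | rfl
  · rw [key _ (letter0 k hk)]; exact hl.1
  · rw [key _ (letter1 k hk)]; exact hl.2.1
  · rw [key _ (letter2 k hk)]; exact hl.2.2

theorem step_dec (k : ℕ) (hk : 2 ≤ k) (a b : Fin (4 * k + 2)) (h : a ≠ b) :
    ∃ A ∈ En (4 * k + 2), ∃ F : Fin (4 * k + 2) → Fin (4 * k + 2), (∀ i, 0 < A i (F i)) ∧
      Pf k (Pn (F a)) (Pn (F b)) + 1 = Pf k (Pn a) (Pn b) := by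
  have hl := dec_all k (Pn a) (Pn b) (by omega) (Pn_InR k _ a.2) (Pn_InR k _ b.2)
    (fun e => h (Fin.ext (Pn_inj _ _ e)))
  rcases hl with hl | hl | hl
  · obtain ⟨F, hF, hf⟩ := letter0 k hk
    exact ⟨_, Or.inl rfl, F, fun i => (hF _ _).2 rfl, by rw [hf, hf, hl]⟩
  · obtain ⟨F, hF, hf⟩ := letter1 k hk
    exact ⟨_, Or.inr (Or.inl rfl), F, fun i => (hF _ _).2 rfl, by rw [hf, hf, hl]⟩
  · obtain ⟨F, hF, hf⟩ := letter2 k hk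
    exact ⟨_, Or.inr (Or.inr rfl), F, fun i => (hF _ _).2 rfl, by rw [hf, hf, hl]⟩

theorem Pf_zero_iff (k : ℕ) (hk : 2 ≤ k) (a b : Fin (4 * k + 2)) (h : Pf k (Pn a) (Pn b) = 0) :
    a = b := by
  by_contra hne
  have := Pf_pos k (Pn a) (Pn b) (by omega) (Pn_InR k _ a.2) (Pn_InR k _ b.2)
    (fun e => hne (Fin.ext (Pn_inj _ _ e)))
  omega

theorem steps_lower (k : ℕ) (hk : 2 ≤ k) (m : ℕ) :
    ∀ (u : Fin (4 * k + 2) × Fin (4 * k + 2)) (s : Fin (4 * k + 2)),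
      stepsTo (sqStep (En (4 * k + 2))) m u (s, s) → Pf k (Pn u.1) (Pn u.2) ≤ m := by
  induction m with
  | zero =>
    intro u s h
    have h : u = (s, s) := h
    rw [h, Pf_self]; simp
  | succ m ih =>
    rintro u s ⟨w, h1, h2⟩
    have := ih w s h2
    have := step_lip k hk u w h1
    push_cast; omega

theorem steps_upper (k : ℕ) (hk : 2 ≤ k) (m : ℕ) :
    ∀ (u : Fin (4 * k + 2) × Fin (4 * k + 2)), Pf k (Pn u.1) (Pn u.2) = m →
      ∃ s, stepsTo (sqStep (En (4 * k + 2))) m u (s, s) := by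
  induction m with
  | zero =>
    intro u h
    have h := Pf_zero_iff k hk u.1 u.2 (by simpa using h)
    exact ⟨u.1, Prod.ext rfl h.symm⟩
  | succ m ih =>
    intro u h
    have hne : u.1 ≠ u.2 := by
      intro e; rw [e, Pf_self] at h; push_cast at h; omega
    obtain ⟨A, hA, F, hF, hd⟩ := step_dec k hk u.1 u.2 hne
    obtain ⟨s, hs⟩ := ih (F u.1, F u.2) (by push_cast at h; simp only; omega)
    exact ⟨s, (F u.1, F u.2), ⟨A, hA, Or.inl ⟨hF _, hF _⟩⟩, hs⟩

theorem dist_eq (k : ℕ) (hk : 2 ≤ k) (u : Fin (4 * k + 2) × Fin (4 * k + 2)) :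
    (sqDistToSingleton (En (4 * k + 2)) u : ℤ) = Pf k (Pn u.1) (Pn u.2) := by
  have h0 := Pf_nonneg k (Pn u.1) (Pn u.2) (by omega) (Pn_InR k _ u.1.2) (Pn_InR k _ u.2.2)
  obtain ⟨m, hm⟩ := Int.eq_ofNat_of_zero_le h0
  have hmem := steps_upper k hk m u hm
  rw [hm]
  norm_cast
  unfold sqDistToSingleton
  apply le_antisymm
  · exact Nat.sInf_le hmem
  · obtain ⟨s, hs⟩ := Nat.sInf_mem (s := {m | ∃ s, stepsTo (sqStep (En (4 * k + 2))) m u (s, s)})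
      ⟨m, hmem⟩
    have := steps_lower k hk _ u s hs
    rw [hm] at this
    exact_mod_cast this

theorem diam_eq (k : ℕ) (hk : 2 ≤ k) :
    (sqDiam (En (4 * k + 2)) : ℤ) = 4 * k ^ 2 + 6 * k - 1 := by
  obtain ⟨D, hD⟩ : ∃ D : ℕ, (D : ℤ) = 4 * k ^ 2 + 6 * k - 1 :=
    ⟨4 * k ^ 2 + 6 * k - 1, by rw [Nat.cast_sub (by nlinarith)]; push_cast; ring⟩
  rw [← hD]
  norm_cast
  have hle : ∀ d ∈ {d | ∃ u : Fin (4 * k + 2) × Fin (4 * k + 2), u.1 ≠ u.2 ∧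
      sqDistToSingleton (En (4 * k + 2)) u = d}, d ≤ D := by
    rintro d ⟨u, -, rfl⟩
    have h := Pf_le k (Pn u.1) (Pn u.2) hk (Pn_InR k _ u.1.2) (Pn_InR k _ u.2.2)
    rw [← dist_eq k hk u, ← hD] at h
    exact_mod_cast h
  have hmem : D ∈ {d | ∃ u : Fin (4 * k + 2) × Fin (4 * k + 2), u.1 ≠ u.2 ∧
      sqDistToSingleton (En (4 * k + 2)) u = d} := by
    refine ⟨(⟨2 * k + 1, by omega⟩, ⟨2 * k, by omega⟩), ?_, ?_⟩
    · intro h; simp at h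
    · have h := dist_eq k hk (⟨2 * k + 1, by omega⟩, ⟨2 * k, by omega⟩)
      have e1 : Pn (2 * k + 1) = -((k : ℤ) + 1) := by unfold Pn; split_ifs <;> omega
      have e2 : Pn (2 * k) = k := by unfold Pn; split_ifs <;> omega
      simp only [e1, e2] at h
      rw [Pf_max k hk, ← hD] at h
      exact_mod_cast h
  unfold sqDiam
  exact le_antisymm (csSup_le ⟨D, hmem⟩ hle) (le_csSup ⟨D, hle⟩ hmem)

theorem mul_pos_entry {n : ℕ} (A B : Matrix (Fin n) (Fin n) ℕ) (a b c : Fin n)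
    (h1 : 0 < A a b) (h2 : 0 < B b c) : 0 < (A * B) a c := by
  rw [Matrix.mul_apply]
  exact Finset.sum_pos' (fun _ _ => Nat.zero_le _) ⟨b, Finset.mem_univ _, Nat.mul_pos h1 h2⟩

theorem merge (k : ℕ) (hk : 2 ≤ k) (m : ℕ) :
    ∀ (a b : Fin (4 * k + 2)), Pf k (Pn a) (Pn b) = m →
      ∃ ws : List (Matrix (Fin (4 * k + 2)) (Fin (4 * k + 2)) ℕ),
        (∀ A ∈ ws, A ∈ En (4 * k + 2)) ∧ ∃ F : Fin (4 * k + 2) → Fin (4 * k + 2),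
        (∀ i, 0 < ws.prod i (F i)) ∧ F a = F b := by
  induction m with
  | zero =>
    intro a b h
    have h := Pf_zero_iff k hk a b (by simpa using h)
    exact ⟨[], by simp, id, by simp, h⟩
  | succ m ih =>
    intro a b h
    have hne : a ≠ b := by
      intro e; rw [e, Pf_self] at h; push_cast at h; omega
    obtain ⟨A, hA, F, hF, hd⟩ := step_dec k hk a b hne
    obtain ⟨ws, hw, G, hG, hab⟩ := ih (F a) (F b) (by push_cast at h; omega)
    refine ⟨A :: ws, ?_, G ∘ F, ?_, hab⟩
    · intro B hB
      rcases List.mem_cons.1 hB with rfl | hB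
      · exact hA
      · exact hw B hB
    · intro i
      rw [List.prod_cons]
      exact mul_pos_entry _ _ _ _ _ (hF i) (hG _)

theorem sync_aux (k : ℕ) (hk : 2 ≤ k) (c : ℕ) :
    ∀ (ws : List (Matrix (Fin (4 * k + 2)) (Fin (4 * k + 2)) ℕ))
      (F : Fin (4 * k + 2) → Fin (4 * k + 2)), ws ≠ [] → (∀ A ∈ ws, A ∈ En (4 * k + 2)) →
      (∀ i, 0 < ws.prod i (F i)) → (Finset.univ.image F).card ≤ c →
      IsSync (En (4 * k + 2)) := by
  induction c with
  | zero =>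
    intro ws F _ _ _ hc
    have : (F ⟨0, by omega⟩) ∈ Finset.univ.image F := Finset.mem_image_of_mem _ (Finset.mem_univ _)
    have := Finset.card_pos.2 ⟨_, this⟩
    omega
  | succ c ih =>
    intro ws F h1 h2 h3 hc
    by_cases hF : ∀ i j, F i = F j
    · exact ⟨ws, h1, h2, F ⟨0, by omega⟩, fun i => by rw [hF _ i]; exact h3 i⟩
    · push Not at hF
      obtain ⟨i, j, hij⟩ := hF
      have h0 := Pf_nonneg k (Pn (F i)) (Pn (F j)) (by omega) (Pn_InR k _ (F i).2)
        (Pn_InR k _ (F j).2)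
      obtain ⟨m, hm⟩ := Int.eq_ofNat_of_zero_le h0
      obtain ⟨ws', hw, G, hG, hab⟩ := merge k hk m (F i) (F j) hm
      refine ih (ws ++ ws') (G ∘ F) (by simp [h1]) ?_ ?_ ?_
      · intro A hA
        rcases List.mem_append.1 hA with hA | hA
        · exact h2 A hA
        · exact hw A hA
      · intro i
        rw [List.prod_append]
        exact mul_pos_entry _ _ _ _ _ (h3 i) (hG _)
      · rw [← Finset.image_image]
        have hlt : ((Finset.univ.image F).image G).card ≠ (Finset.univ.image F).card := by
          intro e
          exact hij (Finset.card_image_iff.1 e (by simp) (by simp) hab)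
        have := Finset.card_image_le (s := Finset.univ.image F) (f := G)
        omega

theorem sync (k : ℕ) (hk : 2 ≤ k) : IsSync (En (4 * k + 2)) := by
  obtain ⟨F, hF, -⟩ := letter0 k hk
  refine sync_aux k hk _ [IbarMat (4 * k + 2)] F (by simp) ?_ ?_ le_rfl
  · intro A hA
    rw [List.mem_singleton.1 hA]; exact Or.inl rfl
  · intro i
    rw [List.prod_singleton]; exact (hF _ _).2 rfl

/-- For `n = 4k + 2`, `k ≥ 2`, the DFA `E'_n = {Ī_{1,n−4}, Q₁, Q₂}` is synchronizing and
the diameter of its square graph equals `(n² + 2n − 12)/4`. -/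
theorem stmt17 (n k : ℕ) (hk : 2 ≤ k) (hn : n = 4 * k + 2) :
    IsSync (En n) ∧ 4 * sqDiam (En n) = n ^ 2 + 2 * n - 12 := by
  subst hn
  refine ⟨sync k hk, ?_⟩
  have h := diam_eq k hk
  have h2 : 12 ≤ (4 * k + 2) ^ 2 + 2 * (4 * k + 2) := by nlinarith
  zify [h2]
  rw [h]; ring
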